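/- For all non-negative integers m and n, the following identity holds in the polynomial ring Q[q, x]: ∑_{k=0}^{m} q^{(m-k)(n-k)} [m choose k]_q [n choose k]_q (x;q)_k = ∑_{i=0}^{m} q^{i(i-1)/2} [n choose i]_q [n+m-i choose n]_q (-x)^i. -/

import Mathlib

open Finset

/-- The q-Pochhammer symbol `(x;q)_n = ∏_{j=0}^{n-1} (1 - x q^j)`. -/
noncomputable def qPoch {F : Type*} [Field F] (q a : F) (n : ℕ) : F :=
  ∏ j ∈ Finset.range n, (1 - a * q ^ j)

/-- The q-binomial coefficient `[n choose k]_q`, which is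
`(q;q)_n / ((q;q)_k (q;q)_{n-k})` for `0 ≤ k ≤ n` and `0` otherwise. -/
noncomputable def qBin {F : Type*} [Field F] (q : F) (n k : ℕ) : F :=
  if k ≤ n then qPoch q q n / (qPoch q q k * qPoch q q (n - k)) else 0

/-- The field of rational functions `ℚ(q, x)`. -/
abbrev F2 : Type := FractionRing (MvPolynomial (Fin 2) ℚ)

noncomputable def q : F2 := algebraMap (MvPolynomial (Fin 2) ℚ) F2 (MvPolynomial.X 0)
noncomputable def x : F2 := algebraMap (MvPolynomial (Fin 2) ℚ) F2 (MvPolynomial.X 1)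

section aux
variable {F : Type*} [Field F]

theorem qPoch_succ' (q a : F) (n : ℕ) : qPoch q a (n + 1) = qPoch q a n * (1 - a * q ^ n) := by
  simp [qPoch, Finset.prod_range_succ]

theorem qPoch_ne (q : F) (hq : ∀ n : ℕ, q ^ (n + 1) ≠ 1) (n : ℕ) : qPoch q q n ≠ 0 := by
  unfold qPoch
  rw [Finset.prod_ne_zero_iff]
  intro j _ h
  apply hq j
  rw [pow_succ']
  exact (sub_eq_zero.mp h).symm

theorem qBin_zero_right (q : F) (hq : ∀ n : ℕ, q ^ (n + 1) ≠ 1) (n : ℕ) : qBin q n 0 = 1 := by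
  have := qPoch_ne q hq n
  simp [qBin]
  simp [qPoch] at *
  exact this

theorem qBin_of_lt (q : F) {n k : ℕ} (h : n < k) : qBin q n k = 0 := by
  simp [qBin, h]

theorem qBin_self (q : F) (hq : ∀ n : ℕ, q ^ (n + 1) ≠ 1) (n : ℕ) : qBin q n n = 1 := by
  have := qPoch_ne q hq n
  simp [qBin]
  simp [qPoch] at *
  exact this

theorem qBin_add (q : F) (k d : ℕ) :
    qBin q (k + d) k = qPoch q q (k + d) / (qPoch q q k * qPoch q q d) := by
  simp [qBin]

theorem pascal1 (q : F) (hq : ∀ n : ℕ, q ^ (n + 1) ≠ 1) (n k : ℕ) :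
    qBin q (n + 1) (k + 1) = q ^ (k + 1) * qBin q n (k + 1) + qBin q n k := by
  rcases lt_trichotomy n k with h | rfl | h
  · rw [qBin_of_lt q h, qBin_of_lt q (by omega), qBin_of_lt q (by omega)]; simp
  · rw [qBin_self q hq, qBin_self q hq, qBin_of_lt q (by omega)]; simp
  · obtain ⟨d, rfl⟩ := Nat.exists_eq_add_of_lt h
    have e1 : k + d + 1 + 1 = (k + 1) + (d + 1) := by ring
    have e2 : k + d + 1 = (k + 1) + d := by ring
    have e3 : k + 1 + d = k + (d + 1) := by ring
    rw [e1, qBin_add, e2, qBin_add, e3, qBin_add]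
    have e4 : k + 1 + (d + 1) = (k + (d + 1)) + 1 := by ring
    rw [e4, qPoch_succ' q q (k + (d + 1)), qPoch_succ' q q k, qPoch_succ' q q d]
    have h1 := qPoch_ne q hq k
    have h2 := qPoch_ne q hq d
    have h3 : 1 - q * q ^ k ≠ 0 := by
      rw [← pow_succ']; exact sub_ne_zero.mpr (hq k).symm
    have h4 : 1 - q * q ^ d ≠ 0 := by
      rw [← pow_succ']; exact sub_ne_zero.mpr (hq d).symm
    field_simp
    ring

theorem pascal2 (q : F) (h0 : q ≠ 0) (hq : ∀ n : ℕ, q ^ (n + 1) ≠ 1) (n k : ℕ) :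
    qBin q (n + 1) (k + 1) = qBin q n (k + 1) + q ^ ((n : ℤ) - k) * qBin q n k := by
  rcases lt_trichotomy n k with h | rfl | h
  · rw [qBin_of_lt q h, qBin_of_lt q (by omega), qBin_of_lt q (by omega)]; simp
  · rw [qBin_self q hq, qBin_self q hq, qBin_of_lt q (by omega)]; simp
  · obtain ⟨d, rfl⟩ := Nat.exists_eq_add_of_lt h
    have e0 : ((k + d + 1 : ℕ) : ℤ) - k = ((d + 1 : ℕ) : ℤ) := by push_cast; ring
    rw [e0, zpow_natCast]
    have e1 : k + d + 1 + 1 = (k + 1) + (d + 1) := by ring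
    have e2 : k + d + 1 = (k + 1) + d := by ring
    have e3 : k + 1 + d = k + (d + 1) := by ring
    rw [e1, qBin_add, e2, qBin_add, e3, qBin_add]
    have e4 : k + 1 + (d + 1) = (k + (d + 1)) + 1 := by ring
    rw [e4, qPoch_succ' q q (k + (d + 1)), qPoch_succ' q q k, qPoch_succ' q q d]
    have h1 := qPoch_ne q hq k
    have h2 := qPoch_ne q hq d
    have h3 : 1 - q * q ^ k ≠ 0 := by
      rw [← pow_succ']; exact sub_ne_zero.mpr (hq k).symm
    have h4 : 1 - q * q ^ d ≠ 0 := by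
      rw [← pow_succ']; exact sub_ne_zero.mpr (hq d).symm
    field_simp
    ring

theorem vand_step (q : F) (h0 : q ≠ 0) (hq : ∀ n : ℕ, q ^ (n + 1) ≠ 1) (m N r : ℕ) :
    ∑ p ∈ antidiagonal r, qBin q m p.1 * qBin q (N + 1) p.2 * q ^ ((p.2 : ℤ) * ((m : ℤ) - p.1)) =
    ∑ p ∈ antidiagonal r,
      qBin q (m + 1) p.1 * qBin q N p.2 * q ^ ((p.2 : ℤ) * (((m + 1 : ℕ) : ℤ) - p.1)) := by
  cases r with
  | zero => simp [qBin_zero_right q hq]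
  | succ r =>
    have key : ∑ p ∈ antidiagonal (r + 1),
        qBin q m p.1 * (q ^ p.2 * qBin q N p.2) * q ^ ((p.2 : ℤ) * ((m : ℤ) - p.1)) =
        ∑ p ∈ antidiagonal (r + 1),
        qBin q m p.1 * (q ^ p.2 * qBin q N p.2) * q ^ ((p.2 : ℤ) * ((m : ℤ) - p.1)) := rfl
    conv_lhs at key => rw [Nat.sum_antidiagonal_succ']
    conv_rhs at key => rw [Nat.sum_antidiagonal_succ]
    rw [Nat.sum_antidiagonal_succ', Nat.sum_antidiagonal_succ]
    simp only [pascal1 q hq N, pascal2 q h0 hq m, qBin_zero_right q hq, mul_add, add_mul,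
      Finset.sum_add_distrib] at key ⊢
    have e1 : ∑ p ∈ antidiagonal r, qBin q m p.1 * qBin q N p.2 *
          q ^ (((p.2 + 1 : ℕ) : ℤ) * ((m : ℤ) - p.1)) =
        ∑ p ∈ antidiagonal r, q ^ ((m : ℤ) - p.1) * qBin q m p.1 * qBin q N p.2 *
          q ^ ((p.2 : ℤ) * (((m + 1 : ℕ) : ℤ) - (p.1 + 1 : ℕ))) := by
      refine Finset.sum_congr rfl fun p _ => ?_
      have : (((p.2 + 1 : ℕ) : ℤ) * ((m : ℤ) - p.1)) = ((m : ℤ) - p.1) +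
        ((p.2 : ℤ) * (((m + 1 : ℕ) : ℤ) - (p.1 + 1 : ℕ))) := by push_cast; ring
      rw [this, zpow_add₀ h0]; ring
    have e2 : ∑ p ∈ antidiagonal r, qBin q m (p.1 + 1) * (q ^ p.2 * qBin q N p.2) *
          q ^ ((p.2 : ℤ) * ((m : ℤ) - (p.1 + 1 : ℕ))) =
        ∑ p ∈ antidiagonal r, qBin q m (p.1 + 1) * qBin q N p.2 *
          q ^ ((p.2 : ℤ) * (((m + 1 : ℕ) : ℤ) - (p.1 + 1 : ℕ))) := by
      refine Finset.sum_congr rfl fun p _ => ?_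
      have : ((p.2 : ℤ) * (((m + 1 : ℕ) : ℤ) - (p.1 + 1 : ℕ))) = (p.2 : ℤ) +
        ((p.2 : ℤ) * ((m : ℤ) - (p.1 + 1 : ℕ))) := by push_cast; ring
      rw [this, zpow_add₀ h0, zpow_natCast]; ring
    have e3 : q ^ (r + 1) * q ^ (((r + 1 : ℕ) : ℤ) * ((m : ℤ) - (0 : ℕ))) =
        q ^ (((r + 1 : ℕ) : ℤ) * (((m + 1 : ℕ) : ℤ) - (0 : ℕ))) := by
      rw [← zpow_natCast, ← zpow_add₀ h0]; congr 1; push_cast; ring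
    rw [e2] at key
    rw [e1, ← e3]
    simp only [Nat.cast_zero, zero_mul, zpow_zero, pow_zero, one_mul, mul_one] at key ⊢
    linear_combination key

theorem vand (q : F) (h0 : q ≠ 0) (hq : ∀ n : ℕ, q ^ (n + 1) ≠ 1) (N : ℕ) : ∀ m r : ℕ,
    ∑ p ∈ antidiagonal r, qBin q m p.1 * qBin q N p.2 * q ^ ((p.2 : ℤ) * ((m : ℤ) - p.1)) =
    qBin q (m + N) r := by
  induction N with
  | zero =>
    intro m r
    rw [Finset.sum_eq_single (r, 0)]
    · simp [qBin_zero_right q hq]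
    · rintro ⟨a, b⟩ h hb
      have : 0 < b := by
        rw [HasAntidiagonal.mem_antidiagonal] at h
        rcases Nat.eq_zero_or_pos b with rfl | h'
        · simp at h; simp [h] at hb
        · exact h'
      simp [qBin_of_lt q this]
    · simp
  | succ N ih =>
    intro m r
    rw [vand_step q h0 hq, ih]
    congr 1; ring

theorem qbinom_thm (q : F) (h0 : q ≠ 0) (hq : ∀ n : ℕ, q ^ (n + 1) ≠ 1) (x : F) (k : ℕ) :
    ∀ N, k ≤ N → qPoch q x k =
      ∑ i ∈ range (N + 1), q ^ (i * (i - 1) / 2) * qBin q k i * (-x) ^ i := by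
  induction k with
  | zero =>
    intro N _
    rw [Finset.sum_range_succ', Finset.sum_eq_zero]
    · simp [qPoch, qBin_zero_right q hq]
    · intro i _
      simp [qBin_of_lt q (Nat.succ_pos i)]
  | succ k ih =>
    intro N hN
    obtain ⟨N, rfl⟩ : ∃ N', N = N' + 1 := ⟨N - 1, by omega⟩
    have a := ih (N + 1) (by omega)
    have b := ih N (by omega)
    rw [Finset.sum_range_succ'] at a ⊢
    rw [qPoch_succ']
    have c : ∑ i ∈ range (N + 1), q ^ ((i + 1) * (i + 1 - 1) / 2) * qBin q (k + 1) (i + 1) *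
        (-x) ^ (i + 1) =
        ∑ i ∈ range (N + 1), q ^ ((i + 1) * (i + 1 - 1) / 2) * qBin q k (i + 1) *
        (-x) ^ (i + 1) + (-x * q ^ k) *
        ∑ i ∈ range (N + 1), q ^ (i * (i - 1) / 2) * qBin q k i * (-x) ^ i := by
      rw [Finset.mul_sum, ← Finset.sum_add_distrib]
      refine Finset.sum_congr rfl fun i _ => ?_
      rw [pascal2 q h0 hq]
      have e : (i + 1) * (i + 1 - 1) / 2 = i * (i - 1) / 2 + i := by
        rw [← Finset.sum_range_id, ← Finset.sum_range_id, Finset.sum_range_succ]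
      have e2 : q ^ i * q ^ ((k : ℤ) - i) = q ^ k := by
        rw [← zpow_natCast, ← zpow_add₀ h0, ← zpow_natCast]; congr 1; ring
      rw [e, pow_add, ← e2]
      ring
    rw [c, ← b]
    simp only [qBin_zero_right q hq] at a ⊢
    linear_combination a

theorem qBin_mul (q : F) (hq : ∀ n : ℕ, q ^ (n + 1) ≠ 1) (n k i : ℕ) (hk : k ≤ n) (hi : i ≤ n) :
    qBin q n k * qBin q k i = qBin q n i * qBin q (n - i) (n - k) := by
  by_cases h : i ≤ k
  · have e : n - i - (n - k) = k - i := by omega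
    have e2 : n - k ≤ n - i := by omega
    simp only [qBin, hk, hi, h, e, e2, if_true]
    have h1 := qPoch_ne q hq k
    have h2 := qPoch_ne q hq (n - i)
    have h3 := qPoch_ne q hq i
    have h4 := qPoch_ne q hq (n - k)
    have h5 := qPoch_ne q hq (k - i)
    field_simp
  · rw [qBin_of_lt q (by omega : k < i), qBin_of_lt q (by omega : n - i < n - k)]; simp

theorem sum_range_swap (f : ℕ → F) (m n : ℕ) (h1 : ∀ k, m < k → k ≤ n → f k = 0)
    (h2 : ∀ k, n < k → k ≤ m → f k = 0) :
    ∑ k ∈ range (m + 1), f k = ∑ k ∈ range (n + 1), f k := by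
  rcases le_total m n with h | h
  · apply Finset.sum_subset (Finset.range_mono (by omega))
    intro k hk hk'
    simp at hk hk'
    exact h1 k (by omega) (by omega)
  · symm
    apply Finset.sum_subset (Finset.range_mono (by omega))
    intro k hk hk'
    simp at hk hk'
    exact h2 k (by omega) (by omega)

theorem general (q x : F) (h0 : q ≠ 0) (hq : ∀ n : ℕ, q ^ (n + 1) ≠ 1) (m n : ℕ) :
    ∑ k ∈ Finset.range (m + 1),
        q ^ (((m : ℤ) - k) * ((n : ℤ) - k)) * qBin q m k * qBin q n k * qPoch q x k =
    ∑ i ∈ Finset.range (m + 1),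
        q ^ (i * (i - 1) / 2) * qBin q n i * qBin q (n + m - i) n * (-x) ^ i := by
  rw [sum_range_swap _ m n (fun k h _ => by simp [qBin_of_lt q h])
    (fun k h _ => by simp [qBin_of_lt q h])]
  rw [sum_range_swap _ m n (fun k h h' => by
      rw [qBin_of_lt q (by omega : n + m - k < n)]; simp)
    (fun k h _ => by simp [qBin_of_lt q h])]
  have a : ∀ k ∈ range (n + 1),
      q ^ (((m : ℤ) - k) * ((n : ℤ) - k)) * qBin q m k * qBin q n k * qPoch q x k =
      ∑ i ∈ range (n + 1), q ^ (i * (i - 1) / 2) * qBin q n i * (-x) ^ i *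
        (qBin q m k * qBin q (n - i) (n - k) * q ^ (((n - k : ℕ) : ℤ) * ((m : ℤ) - k))) := by
    intro k hk
    have hk' : k ≤ n := by simp at hk; omega
    rw [qbinom_thm q h0 hq x k n hk', Finset.mul_sum]
    refine Finset.sum_congr rfl fun i hi => ?_
    have hi' : i ≤ n := by simp at hi; omega
    have := qBin_mul q hq n k i hk' hi'
    rw [Nat.cast_sub hk', mul_comm ((n : ℤ) - k)]
    linear_combination (q ^ (((m : ℤ) - k) * ((n : ℤ) - k)) * qBin q m k *
      q ^ (i * (i - 1) / 2) * (-x) ^ i) * this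
  rw [Finset.sum_congr rfl a, Finset.sum_comm]
  refine Finset.sum_congr rfl fun i hi => ?_
  have hi' : i ≤ n := by simp at hi; omega
  have v := vand q h0 hq (n - i) m n
  rw [Finset.Nat.sum_antidiagonal_eq_sum_range_succ_mk] at v
  rw [← Finset.mul_sum, v, (by omega : m + (n - i) = n + m - i)]
  ring

end aux

theorem q_ne_aux : q ≠ 0 := by
  unfold q
  rw [Ne, FaithfulSMul.algebraMap_eq_zero_iff]
  exact MvPolynomial.X_ne_zero 0

theorem q_pow_aux (n : ℕ) : q ^ (n + 1) ≠ 1 := by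
  unfold q
  intro h
  rw [← map_pow, ← map_one (algebraMap (MvPolynomial (Fin 2) ℚ) F2)] at h
  have h2 := FaithfulSMul.algebraMap_injective (MvPolynomial (Fin 2) ℚ) F2 h
  have h3 := congrArg (MvPolynomial.eval (fun _ => (0 : ℚ))) h2
  simp at h3

theorem qDelannoy_generating_identity (m n : ℕ) :
    ∑ k ∈ Finset.range (m + 1),
        q ^ (((m : ℤ) - k) * ((n : ℤ) - k)) * qBin q m k * qBin q n k * qPoch q x k =
    ∑ i ∈ Finset.range (m + 1),
        q ^ (i * (i - 1) / 2) * qBin q n i * qBin q (n + m - i) n * (-x) ^ i := by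
  exact general q x q_ne_aux q_pow_aux m n
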